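/- If G is hyperbolic relative to torsion-free subgroups {H_λ}_{λ∈Λ} and G is residually finite, then G is virtually torsion-free, that is, G contains a torsion-free subgroup of finite index. -/

import Mathlib

namespace RelHyp

variable {G : Type*} [Group G] {Λ : Type*}

/-- Length of a shortest word over the alphabet `S ∪ S⁻¹` representing `g`. -/
noncomputable def wordLength (S : Set G) (g : G) : ℕ :=
  sInf {n | ∃ w : List G, w.length = n ∧ (∀ x ∈ w, x ∈ S ∨ x⁻¹ ∈ S) ∧ w.prod = g}

/-- The free product `F = (∗_λ H_λ) ∗ F(X)`. -/
abbrev RelFree (H : Λ → Subgroup G) (X : Set G) : Type _ :=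
  Monoid.Coprod (Monoid.CoprodI fun l => ↥(H l)) (FreeGroup ↥X)

/-- The canonical homomorphism `ε : F → G`. -/
def relEps (H : Λ → Subgroup G) (X : Set G) : RelFree H X →* G :=
  Monoid.Coprod.lift (Monoid.CoprodI.lift fun l => (H l).subtype)
    (FreeGroup.lift fun x => (x : G))

/-- Letters of the alphabet `X ∪ 𝓗`, where `𝓗 = ⊔_λ (H̃_λ ∖ {1})`. -/
abbrev RelLetter (H : Λ → Subgroup G) (X : Set G) : Type _ :=
  (Σ l : Λ, {h : ↥(H l) // h ≠ 1}) ⊕ (↥X × Bool)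

/-- The image of a letter in the free product `F`. -/
def RelLetter.toF {H : Λ → Subgroup G} {X : Set G} : RelLetter H X → RelFree H X
  | Sum.inl ⟨_, h⟩ => Monoid.Coprod.inl (Monoid.CoprodI.of h.1)
  | Sum.inr (x, b) => Monoid.Coprod.inr (if b then FreeGroup.of x else (FreeGroup.of x)⁻¹)

/-- The element of `G` represented by a letter. -/
def RelLetter.val {H : Λ → Subgroup G} {X : Set G} : RelLetter H X → G
  | Sum.inl ⟨_, h⟩ => (h.1 : G)
  | Sum.inr (x, b) => if b then (x : G) else (x : G)⁻¹

/-- The index `λ` such that the letter belongs to `H̃_λ`, if any. -/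
def RelLetter.hIndex {H : Λ → Subgroup G} {X : Set G} : RelLetter H X → Option Λ
  | Sum.inl ⟨l, _⟩ => some l
  | Sum.inr _ => none

/-- The element of `F` represented by a word over `X ∪ 𝓗`. -/
def wordToF {H : Λ → Subgroup G} {X : Set G} (w : List (RelLetter H X)) : RelFree H X :=
  (w.map RelLetter.toF).prod

/-- `f` is a relative isoperimetric function of the relative presentation `⟨X, H | R⟩`. -/
def IsIsoperFn (H : Λ → Subgroup G) (X : Set G) (R : Set (RelFree H X)) (f : ℕ → ℕ) : Prop :=
  ∀ w : List (RelLetter H X), relEps H X (wordToF w) = 1 →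
    ∃ k ≤ f w.length, ∃ r c : Fin k → RelFree H X,
      (∀ i, r i ∈ R) ∧ wordToF w = (List.ofFn fun i => (c i)⁻¹ * r i * c i).prod

/-- `⟨X, H | R⟩` is a finite relative presentation of `G` w.r.t. the collection `H`. -/
structure IsFiniteRelPres (H : Λ → Subgroup G) (X : Set G) (R : Set (RelFree H X)) : Prop where
  finX : X.Finite
  finR : R.Finite
  surj : Function.Surjective (relEps H X)
  ker : (relEps H X).ker = Subgroup.normalClosure R

/-- `G` is finitely presented relative to the collection of subgroups `H`. -/
def FinitelyPresentedRel (H : Λ → Subgroup G) : Prop :=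
  ∃ (X : Set G) (R : Set (RelFree H X)), IsFiniteRelPres H X R

/-- The relative area of a word representing `1`. -/
noncomputable def relArea (H : Λ → Subgroup G) (X : Set G) (R : Set (RelFree H X))
    (w : List (RelLetter H X)) : ℕ :=
  sInf {k | ∃ r c : Fin k → RelFree H X,
    (∀ i, r i ∈ R) ∧ wordToF w = (List.ofFn fun i => (c i)⁻¹ * r i * c i).prod}

/-- The relative Dehn function of the presentation `⟨X, H | R⟩`. -/
noncomputable def relDehn (H : Λ → Subgroup G) (X : Set G) (R : Set (RelFree H X))
    (n : ℕ) : ℕ :=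
  sSup {a | ∃ w : List (RelLetter H X), w.length ≤ n ∧ relEps H X (wordToF w) = 1 ∧
    a = relArea H X R w}

/-- The relative Dehn function is well-defined (finite for each value of the argument),
i.e. there exists a finite-valued relative isoperimetric function. -/
def DehnWellDefined (H : Λ → Subgroup G) (X : Set G) (R : Set (RelFree H X)) : Prop :=
  ∃ f : ℕ → ℕ, IsIsoperFn H X R f

/-- `f ⪯ g`. -/
def AsympLE (f g : ℕ → ℕ) : Prop := ∃ C K L : ℕ, ∀ n, f n ≤ C * g (K * n) + L * n

/-- `f ∼ g`. -/
def AsympEquiv (f g : ℕ → ℕ) : Prop := AsympLE f g ∧ AsympLE g f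

/-- `G` is hyperbolic relative to `H`: it admits a finite relative presentation with a
linear relative isoperimetric function. -/
def IsRelHyperbolic (H : Λ → Subgroup G) : Prop :=
  ∃ (X : Set G) (R : Set (RelFree H X)), IsFiniteRelPres H X R ∧
    ∃ A B : ℕ, IsIsoperFn H X R fun n => A * n + B

/-- The subnegative closure of `f`. -/
noncomputable def subnegClosure (f : ℕ → ℕ) (n : ℕ) : ℕ :=
  sSup {s | ∃ L : List ℕ, (∀ a ∈ L, 0 < a) ∧ L.sum = n ∧ s = (L.map f).sum}

/-- A combinatorial path in the Cayley graph `Γ(G, X ∪ 𝓗)`: a starting vertex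
together with the word labelling the path. -/
structure RelPath (H : Λ → Subgroup G) (X : Set G) where
  start : G
  word : List (RelLetter H X)

namespace RelPath

variable {H : Λ → Subgroup G} {X : Set G}

/-- The length of the path. -/
def len (p : RelPath H X) : ℕ := p.word.length

/-- The `k`-th vertex of the path. -/
def vertex (p : RelPath H X) (k : ℕ) : G :=
  p.start * ((p.word.take k).map RelLetter.val).prod

/-- The terminal vertex of the path. -/
def finish (p : RelPath H X) : G := p.vertex p.word.length

end RelPath

/-- The combinatorial metric `dist_{X ∪ 𝓗}` on `G`. -/
noncomputable def relDist (H : Λ → Subgroup G) (X : Set G) (g h : G) : ℕ :=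
  wordLength (X ∪ ⋃ l, (H l : Set G)) (g⁻¹ * h)

/-- The relative length `|g|_{X ∪ 𝓗}`. -/
noncomputable def relLen (H : Λ → Subgroup G) (X : Set G) (g : G) : ℕ :=
  wordLength (X ∪ ⋃ l, (H l : Set G)) g

/-- The word metric `dist_X` on `G`. -/
noncomputable def xDist (X : Set G) (g h : G) : ℕ := wordLength X (g⁻¹ * h)

variable {H : Λ → Subgroup G} {X : Set G}

/-- `p` is a `(λ, c)`-quasi-geodesic in `Γ(G, X ∪ 𝓗)`. -/
def IsQuasiGeodesic (lam c : ℝ) (p : RelPath H X) : Prop :=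
  ∀ i j : ℕ, i ≤ j → j ≤ p.len →
    ((j - i : ℕ) : ℝ) ≤ lam * (relDist H X (p.vertex i) (p.vertex j) : ℝ) + c

/-- `p` is a geodesic in `Γ(G, X ∪ 𝓗)`. -/
def IsGeodesic (p : RelPath H X) : Prop :=
  ∀ i j : ℕ, i ≤ j → j ≤ p.len → j - i = relDist H X (p.vertex i) (p.vertex j)

/-- The `k`-th letter of `p` is a letter of `H̃_l`. -/
def LetterIsH (p : RelPath H X) (l : Λ) (k : ℕ) : Prop :=
  ∃ a, p.word[k]? = some a ∧ a.hIndex = some l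

/-- The subpath of `p` consisting of the letters with indices `a, …, b` is an
`H_l`-component of `p` (a maximal nonempty `H_l`-subword). -/
def IsComponent (p : RelPath H X) (l : Λ) (a b : ℕ) : Prop :=
  a ≤ b ∧ b < p.len ∧ (∀ k, a ≤ k → k ≤ b → LetterIsH p l k) ∧
    (a = 0 ∨ ¬ LetterIsH p l (a - 1)) ∧ (b + 1 = p.len ∨ ¬ LetterIsH p l (b + 1))

/-- The `H_l`-components of `p` starting at index `a` and of `q` starting at `a'`
are connected (their vertices lie in the same left coset of `H_l`). -/
def ConnectedComp (p q : RelPath H X) (l : Λ) (a a' : ℕ) : Prop :=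
  (p.vertex a)⁻¹ * q.vertex a' ∈ H l

/-- `p` is a path without backtracking: all of its components are isolated. -/
def NoBacktracking (p : RelPath H X) : Prop :=
  ∀ l a b a' b', IsComponent p l a b → IsComponent p l a' b' →
    ConnectedComp p p l a a' → a = a' ∧ b = b'

/-- The `k`-th vertex of `p` is a phase vertex (not an inner vertex of a component). -/
def IsPhase (p : RelPath H X) (k : ℕ) : Prop :=
  ¬ ∃ l a b, IsComponent p l a b ∧ a < k ∧ k ≤ b

/-- `p` and `q` are `k`-similar: their endpoints are `X`-distance at most `k` apart. -/
def Similar (k : ℝ) (p q : RelPath H X) : Prop :=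
  (xDist X p.start q.start : ℝ) ≤ k ∧ (xDist X p.finish q.finish : ℝ) ≤ k

/-- The Rips thin-triangles condition for `Γ(G, X ∪ 𝓗)` with constant `δ`. -/
def RipsThin (H : Λ → Subgroup G) (X : Set G) (δ : ℝ) : Prop :=
  ∀ p q r : RelPath H X, IsGeodesic p → IsGeodesic q → IsGeodesic r →
    p.finish = q.start → q.finish = r.start → r.finish = p.start →
    ∀ i ≤ p.len, ∃ j : ℕ,
      (j ≤ q.len ∧ (relDist H X (p.vertex i) (q.vertex j) : ℝ) ≤ δ) ∨
      (j ≤ r.len ∧ (relDist H X (p.vertex i) (r.vertex j) : ℝ) ≤ δ)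

/-- The Cayley graph `Γ(G, X ∪ 𝓗)` is a hyperbolic metric space. -/
def CayleyHyperbolic (H : Λ → Subgroup G) (X : Set G) : Prop :=
  ∃ δ : ℝ, 0 ≤ δ ∧ RipsThin H X δ

/-- `R` is a relatively quasi-convex subgroup of `G`. -/
def RelQuasiconvex (H : Λ → Subgroup G) (X : Set G) (R : Subgroup G) : Prop :=
  ∃ σ : ℝ, 0 < σ ∧ ∀ p : RelPath H X, IsGeodesic p → p.start ∈ R → p.finish ∈ R →
    ∀ k ≤ p.len, ∃ w ∈ R, (xDist X (p.vertex k) w : ℝ) ≤ σ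

/-- `R` is a strongly relatively quasi-convex subgroup of `G`. -/
def StronglyRelQuasiconvex (H : Λ → Subgroup G) (X : Set G) (R : Subgroup G) : Prop :=
  RelQuasiconvex H X R ∧ ∀ (g : G) (l : Λ), {x : G | x ∈ R ∧ g * x * g⁻¹ ∈ H l}.Finite

/-- `g` is a hyperbolic element: it is not conjugate to an element of any `H_λ`. -/
def IsHypElt (H : Λ → Subgroup G) (g : G) : Prop :=
  ∀ l : Λ, ∀ x ∈ H l, ¬ IsConj g x

end RelHyp

open RelHyp

namespace RelHyp

variable {G : Type*} [Group G] {Λ : Type*} {H : Λ → Subgroup G} {X : Set G}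

/-! ### Words and the relative length -/

@[simp] theorem wordToF_nil : wordToF ([] : List (RelLetter H X)) = 1 := rfl

@[simp] theorem wordToF_cons (s : RelLetter H X) (w : List (RelLetter H X)) :
    wordToF (s :: w) = s.toF * wordToF w := by
  simp [wordToF]

@[simp] theorem wordToF_append (v w : List (RelLetter H X)) :
    wordToF (v ++ w) = wordToF v * wordToF w := by
  simp [wordToF]

@[simp] theorem relEps_toF (s : RelLetter H X) : relEps H X s.toF = s.val := by
  rcases s with ⟨l, h⟩ | ⟨x, b⟩
  · simp [RelLetter.toF, RelLetter.val, relEps]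
  · cases b <;> simp [RelLetter.toF, RelLetter.val, relEps]

/-- The formal inverse of a letter. -/
def RelLetter.inv : RelLetter H X → RelLetter H X
  | Sum.inl ⟨l, h⟩ => Sum.inl ⟨l, ⟨h.1⁻¹, inv_ne_one.mpr h.2⟩⟩
  | Sum.inr (x, b) => Sum.inr (x, !b)

@[simp] theorem RelLetter.toF_inv (s : RelLetter H X) : s.inv.toF = s.toF⁻¹ := by
  rcases s with ⟨l, h⟩ | ⟨x, b⟩
  · refine eq_inv_of_mul_eq_one_left ?_
    simp only [RelLetter.inv, RelLetter.toF]
    rw [← map_mul, ← map_mul]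
    simp
  · cases b <;> simp [RelLetter.toF, RelLetter.inv]

theorem exists_word_inv (w : List (RelLetter H X)) :
    ∃ v : List (RelLetter H X), v.length = w.length ∧ wordToF v = (wordToF w)⁻¹ := by
  induction w with
  | nil => exact ⟨[], by simp⟩
  | cons s w ih =>
    obtain ⟨v, hv, hvw⟩ := ih
    exact ⟨v ++ [s.inv], by simp [hv], by simp [hvw]⟩

/-- An element of some `H̃_l` is represented by a word of length at most one. -/
theorem exists_word_of_mem {l : Λ} (h : H l) :
    ∃ v : List (RelLetter H X), v.length ≤ 1 ∧
      wordToF v = Monoid.Coprod.inl (Monoid.CoprodI.of (M := fun l => ↥(H l)) h) := by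
  by_cases h1 : h = 1
  · exact ⟨[], by simp, by simp [h1]⟩
  · exact ⟨[Sum.inl ⟨l, ⟨h, h1⟩⟩], by simp, by simp [RelLetter.toF]⟩

theorem wordToF_surjective :
    Function.Surjective (wordToF : List (RelLetter H X) → RelFree H X) := by
  intro f
  induction f using Monoid.Coprod.induction_on with
  | inl m =>
    induction m using Monoid.CoprodI.induction_on with
    | one => exact ⟨[], by simp⟩
    | of l h =>
      obtain ⟨v, -, hv⟩ := exists_word_of_mem (X := X) h
      exact ⟨v, hv⟩
    | mul a b ha hb =>
      obtain ⟨v, hv⟩ := ha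
      obtain ⟨w, hw⟩ := hb
      exact ⟨v ++ w, by simp [hv, hw]⟩
  | inr n =>
    induction n using FreeGroup.induction_on with
    | C1 => exact ⟨[], by simp⟩
    | of x => exact ⟨[Sum.inr (x, true)], by simp [RelLetter.toF]⟩
    | inv_of x _ => exact ⟨[Sum.inr (x, false)], by simp [RelLetter.toF]⟩
    | mul a b ha hb =>
      obtain ⟨v, hv⟩ := ha
      obtain ⟨w, hw⟩ := hb
      exact ⟨v ++ w, by simp [hv, hw]⟩
  | mul a b ha hb =>
    obtain ⟨v, hv⟩ := ha
    obtain ⟨w, hw⟩ := hb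
    exact ⟨v ++ w, by simp [hv, hw]⟩

/-- The least length of a word over `X ∪ 𝓗` representing `g`. -/
noncomputable def minLen (H : Λ → Subgroup G) (X : Set G) (g : G) : ℕ :=
  sInf {n | ∃ w : List (RelLetter H X), w.length = n ∧ relEps H X (wordToF w) = g}

theorem minLen_le (w : List (RelLetter H X)) :
    minLen H X (relEps H X (wordToF w)) ≤ w.length :=
  Nat.sInf_le ⟨w, rfl, rfl⟩

theorem exists_word_minLen (hs : Function.Surjective (relEps H X)) (g : G) :
    ∃ w : List (RelLetter H X), w.length = minLen H X g ∧ relEps H X (wordToF w) = g := by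
  have hne : {n | ∃ w : List (RelLetter H X),
      w.length = n ∧ relEps H X (wordToF w) = g}.Nonempty := by
    obtain ⟨f, rfl⟩ := hs g
    obtain ⟨w, rfl⟩ := wordToF_surjective f
    exact ⟨_, w, rfl, rfl⟩
  exact Nat.sInf_mem hne

@[simp] theorem minLen_one : minLen H X 1 = 0 := by
  simpa using minLen_le ([] : List (RelLetter H X))

theorem minLen_mul_le (hs : Function.Surjective (relEps H X)) (g h : G) :
    minLen H X (g * h) ≤ minLen H X g + minLen H X h := by
  obtain ⟨v, hv, hvg⟩ := exists_word_minLen hs g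
  obtain ⟨w, hw, hwh⟩ := exists_word_minLen hs h
  simpa [hvg, hwh, hv, hw] using minLen_le (v ++ w)

theorem minLen_inv_le (hs : Function.Surjective (relEps H X)) (g : G) :
    minLen H X g⁻¹ ≤ minLen H X g := by
  obtain ⟨w, hw, hwg⟩ := exists_word_minLen hs g
  obtain ⟨v, hv, hvw⟩ := exists_word_inv w
  simpa [hvw, hwg, hv, hw] using minLen_le v

theorem minLen_inv (hs : Function.Surjective (relEps H X)) (g : G) :
    minLen H X g⁻¹ = minLen H X g :=
  (minLen_inv_le hs g).antisymm (by simpa using minLen_inv_le hs g⁻¹)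

theorem minLen_le_one_of_mem {l : Λ} {h : G} (hh : h ∈ H l) : minLen H X h ≤ 1 := by
  obtain ⟨v, hv, hvh⟩ := exists_word_of_mem (X := X) (⟨h, hh⟩ : H l)
  have := minLen_le v
  rw [hvh] at this
  simp only [relEps, Monoid.Coprod.lift_apply_inl, Monoid.CoprodI.lift_of,
    Subgroup.subtype_apply] at this
  exact this.trans hv

theorem minLen_val_le (s : RelLetter H X) : minLen H X s.val ≤ 1 := by
  simpa using minLen_le [s]

/-- The word metric on `G` with respect to `X ∪ 𝓗`. -/
noncomputable def wdist (H : Λ → Subgroup G) (X : Set G) (g h : G) : ℕ :=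
  minLen H X (g⁻¹ * h)

@[simp] theorem wdist_self (g : G) : wdist H X g g = 0 := by simp [wdist]

theorem wdist_comm (hs : Function.Surjective (relEps H X)) (g h : G) :
    wdist H X g h = wdist H X h g := by
  rw [wdist, wdist, ← minLen_inv hs, mul_inv_rev, inv_inv]

theorem wdist_triangle (hs : Function.Surjective (relEps H X)) (a b c : G) :
    wdist H X a c ≤ wdist H X a b + wdist H X b c := by
  simpa [wdist, mul_assoc] using minLen_mul_le hs (a⁻¹ * b) (b⁻¹ * c)

theorem wdist_mul_word (g : G) (w : List (RelLetter H X)) :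
    wdist H X g (g * relEps H X (wordToF w)) ≤ w.length := by
  simpa [wdist] using minLen_le w

theorem wdist_mul_val (g : G) (s : RelLetter H X) : wdist H X g (g * s.val) ≤ 1 := by
  simpa [wdist] using minLen_val_le s

/-! ### Crossed homomorphisms on the free product -/

/-- `c` is a crossed homomorphism from `F` to the functions on `G`; `c s g` is to be thought of
as the integral of a one-form along the path with origin `g` and label `s`. -/
def IsCocycle (c : RelFree H X → G → ℤ) : Prop :=
  ∀ s t g, c (s * t) g = c s g + c t (g * relEps H X s)

/-- The value of the crossed homomorphism `h ↦ (x ↦ Φ (x⁻¹ * h) - Φ x⁻¹)` on a subgroup. -/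
def potentialHom (K : Subgroup G) (Φ : G → ℤ) :
    K →* (G → Multiplicative ℤ) ⋊[mulAutArrow] G where
  toFun h := ⟨fun x => Multiplicative.ofAdd (Φ (x⁻¹ * h) - Φ x⁻¹), h⟩
  map_one' := by ext x <;> simp
  map_mul' a b := by
    ext x
    · rw [SemidirectProduct.mul_left]
      change Φ (x⁻¹ * (a * b : G)) - Φ x⁻¹ =
        Φ (x⁻¹ * a) - Φ x⁻¹ + (Φ (((a : G)⁻¹ * x)⁻¹ * b) - Φ ((a : G)⁻¹ * x)⁻¹)
      simp [mul_assoc]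
    · simp

theorem exists_cocycle (Φ : Λ → G → ℤ) (ω : X → G → ℤ) :
    ∃ c : RelFree H X → G → ℤ, IsCocycle c ∧
      (∀ l (h : H l) g, c (Monoid.Coprod.inl (Monoid.CoprodI.of (M := fun l => ↥(H l)) h)) g =
        Φ l (g * h) - Φ l g) ∧
      ∀ x g, c (Monoid.Coprod.inr (FreeGroup.of x)) g = ω x g := by
  let θ : RelFree H X →* (G → Multiplicative ℤ) ⋊[mulAutArrow] G :=
    Monoid.Coprod.lift (Monoid.CoprodI.lift fun l => potentialHom (H l) (Φ l))
      (FreeGroup.lift fun x => ⟨fun g => Multiplicative.ofAdd (ω x g⁻¹), (x : G)⟩)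
  have hθ : SemidirectProduct.rightHom.comp θ = relEps H X := by
    ext <;> simp [θ, relEps, potentialHom]
  have hr : ∀ s, (θ s).right = relEps H X s := fun s => DFunLike.congr_fun hθ s
  refine ⟨fun s g => Multiplicative.toAdd ((θ s).left g⁻¹), ?_, ?_, ?_⟩
  · intro s t g
    beta_reduce
    rw [MonoidHom.map_mul, SemidirectProduct.mul_left, hr, mul_inv_rev]
    rfl
  · intro l h g
    simp [θ, potentialHom]
  · intro x g
    simp [θ]

namespace IsCocycle

variable {c : RelFree H X → G → ℤ}

theorem map_one (hc : IsCocycle c) (g : G) : c 1 g = 0 := by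
  simpa using hc 1 1 g

theorem map_inv (hc : IsCocycle c) (s : RelFree H X) (g : G) :
    c s⁻¹ g = -c s (g * (relEps H X s)⁻¹) := by
  have := hc s⁻¹ s g
  rw [inv_mul_cancel, hc.map_one, _root_.map_inv] at this
  linarith

theorem map_conj (hc : IsCocycle c) {r : RelFree H X} (hr : relEps H X r = 1)
    (s : RelFree H X) (g : G) :
    c (s⁻¹ * r * s) g = c r (g * (relEps H X s)⁻¹) := by
  rw [hc, hc, hc.map_inv]
  simp [hr]

theorem map_prod_conj (hc : IsCocycle c) {k : ℕ} (r s : Fin k → RelFree H X)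
    (hr : ∀ i, relEps H X (r i) = 1) (g : G) :
    c (List.ofFn fun i => (s i)⁻¹ * r i * s i).prod g =
      ∑ i, c (r i) (g * (relEps H X (s i))⁻¹) := by
  induction k with
  | zero => simpa using hc.map_one g
  | succ k ih =>
    rw [List.ofFn_succ, List.prod_cons, hc, hc.map_conj (hr 0), Fin.sum_univ_succ,
      ← ih (fun i => r i.succ) (fun i => s i.succ) fun i => hr i.succ]
    simp [hr]

end IsCocycle

theorem IsFiniteRelPres.relEps_eq_one {R : Set (RelFree H X)} (hp : IsFiniteRelPres H X R)
    {r : RelFree H X} (hr : r ∈ R) : relEps H X r = 1 := by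
  rw [← MonoidHom.mem_ker, hp.ker]
  exact Subgroup.subset_normalClosure hr

/-- A null-homotopic word bounds few relators: every crossed homomorphism takes on it the sum of
its values on these relators. -/
theorem exists_relators {R : Set (RelFree H X)} (hp : IsFiniteRelPres H X R) {f : ℕ → ℕ}
    (hf : IsIsoperFn H X R f) (w : List (RelLetter H X)) (hw : relEps H X (wordToF w) = 1)
    (g : G) :
    ∃ k ≤ f w.length, ∃ (r : Fin k → RelFree H X) (b : Fin k → G), (∀ i, r i ∈ R) ∧
      ∀ c : RelFree H X → G → ℤ, IsCocycle c → c (wordToF w) g = ∑ i, c (r i) (b i) := by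
  obtain ⟨k, hk, r, s, hr, h⟩ := hf w hw
  refine ⟨k, hk, r, fun i => g * (relEps H X (s i))⁻¹, hr, fun c hc => ?_⟩
  rw [h, hc.map_prod_conj r s fun i => hp.relEps_eq_one (hr i)]

/-- The relators of a finite relative presentation are represented by words of bounded length. -/
theorem IsFiniteRelPres.exists_words {R : Set (RelFree H X)} (hp : IsFiniteRelPres H X R) :
    ∃ (wd : RelFree H X → List (RelLetter H X)) (ℓ : ℕ),
      ∀ r ∈ R, wordToF (wd r) = r ∧ (wd r).length ≤ ℓ := by
  choose wd hwd using wordToF_surjective (H := H) (X := X)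
  obtain ⟨ℓ, hℓ⟩ := (hp.finR.image fun r => (wd r).length).bddAbove
  exact ⟨wd, ℓ, fun r hr => ⟨hwd r, hℓ ⟨r, hr, rfl⟩⟩⟩

end RelHyp
namespace RelHyp

variable {G : Type*} [Group G] {Λ : Type*} {H : Λ → Subgroup G} {X : Set G}

/-! ### Infinite paths -/

/-- The `k`-th vertex of the infinite path with origin `1` and label `s`. -/
def pathVertex (s : ℕ → RelLetter H X) : ℕ → G
  | 0 => 1
  | k + 1 => pathVertex s k * (s k).val

/-- The word formed by the `m` letters of `s` that follow the `i`-th vertex. -/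
def segment (s : ℕ → RelLetter H X) (i m : ℕ) : List (RelLetter H X) :=
  (List.range m).map fun t => s (i + t)

@[simp] theorem length_segment (s : ℕ → RelLetter H X) (i m : ℕ) :
    (segment s i m).length = m := by
  simp [segment]

theorem segment_succ (s : ℕ → RelLetter H X) (i m : ℕ) :
    segment s i (m + 1) = segment s i m ++ [s (i + m)] := by
  simp [segment, List.range_succ]

theorem pathVertex_add (s : ℕ → RelLetter H X) (i m : ℕ) :
    pathVertex s (i + m) = pathVertex s i * relEps H X (wordToF (segment s i m)) := by
  induction m with
  | zero => simp [segment]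
  | succ m ih =>
    rw [segment_succ, ← add_assoc, pathVertex, ih]
    simp [mul_assoc]

theorem IsCocycle.map_segment {c : RelFree H X → G → ℤ} (hc : IsCocycle c)
    (s : ℕ → RelLetter H X) (i m : ℕ) :
    c (wordToF (segment s i m)) (pathVertex s i) =
      ∑ t ∈ Finset.range m, c (s (i + t)).toF (pathVertex s (i + t)) := by
  induction m with
  | zero => simpa [segment] using hc.map_one _
  | succ m ih =>
    rw [segment_succ, wordToF_append, hc, ih, Finset.sum_range_succ, ← pathVertex_add]
    simp

/-- The infinite path labelled by `s` runs `n` times around a closed path whose label has period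
`L`, its subpaths of length at most `L` are geodesic, and the elements represented by its
subpaths of length `L` are not parabolic. -/
structure IsCyclicGeodesic (s : ℕ → RelLetter H X) (L n : ℕ) : Prop where
  pos : 0 < L
  pos_mul : 0 < n
  periodic : ∀ k, s (k + L) = s k
  closed : pathVertex s L ^ n = 1
  geodesic : ∀ i m, m ≤ L → wdist H X (pathVertex s i) (pathVertex s (i + m)) = m
  not_mem : ∀ i l, (pathVertex s i)⁻¹ * pathVertex s (i + L) ∉ H l

theorem pathVertex_add_period {s : ℕ → RelLetter H X} {L : ℕ} (h : ∀ k, s (k + L) = s k)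
    (k : ℕ) : pathVertex s (k + L) = pathVertex s L * pathVertex s k := by
  induction k with
  | zero => simp [pathVertex]
  | succ k ih => rw [add_right_comm, pathVertex, ih, h, pathVertex, mul_assoc]

theorem pathVertex_add_mul_period {s : ℕ → RelLetter H X} {L : ℕ} (h : ∀ k, s (k + L) = s k)
    (k n : ℕ) : pathVertex s (k + n * L) = pathVertex s L ^ n * pathVertex s k := by
  induction n with
  | zero => simp
  | succ n ih =>
    rw [add_mul, one_mul, ← add_assoc, pathVertex_add_period h, ih, pow_succ', mul_assoc]

theorem letter_add_mul_period {s : ℕ → RelLetter H X} {L : ℕ} (h : ∀ k, s (k + L) = s k)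
    (k n : ℕ) : s (k + n * L) = s k := by
  induction n with
  | zero => simp
  | succ n ih => rw [add_mul, one_mul, ← add_assoc, h, ih]

theorem IsCyclicGeodesic.pathVertex_closed {s : ℕ → RelLetter H X} {L n : ℕ}
    (h : IsCyclicGeodesic s L n) (k : ℕ) : pathVertex s (k + n * L) = pathVertex s k := by
  rw [pathVertex_add_mul_period h.periodic, h.closed, one_mul]

theorem exists_isCyclicGeodesic (hs : Function.Surjective (relEps H X))
    (htf : ∀ l : Λ, ∀ h ∈ H l, h ≠ 1 → ¬ IsOfFinOrder h) {g : G} (hg : g ≠ 1)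
    (hfin : IsOfFinOrder g) :
    ∃ (s : ℕ → RelLetter H X) (L n : ℕ), IsCyclicGeodesic s L n ∧ IsConj g (pathVertex s L) := by
  classical
  have hex : ∃ L, ∃ g', IsConj g g' ∧ minLen H X g' = L := ⟨_, g, IsConj.refl g, rfl⟩
  obtain ⟨g', hgg', hL⟩ := Nat.find_spec hex
  have hmin : ∀ g'', IsConj g g'' → Nat.find hex ≤ minLen H X g'' := fun g'' h =>
    Nat.find_min' hex ⟨g'', h, rfl⟩
  obtain ⟨w, hw, hwg⟩ := exists_word_minLen hs g'
  rw [hL] at hw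
  revert hw hmin
  generalize Nat.find hex = L
  intro hmin hw
  have hg' : g' ≠ 1 := by
    rintro rfl
    exact hg (isConj_one_left.mp hgg')
  have hpos : 0 < L := by
    rcases Nat.eq_zero_or_pos L with h | h
    · rw [h, List.length_eq_zero_iff] at hw
      simp [hw] at hwg
      exact absurd hwg.symm hg'
    · exact h
  have hlt : ∀ k, k % L < w.length := fun k => by
    rw [hw]
    exact Nat.mod_lt k hpos
  let s : ℕ → RelLetter H X := fun k => w[k % L]'(hlt k)
  have hper : ∀ k, s (k + L) = s k := fun k => by simp [s]
  have hseg : segment s 0 L = w := by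
    apply List.ext_getElem (by simp [hw])
    intro i h1 h2
    have hi : i < L := by simpa using h1
    simp [segment, s, Nat.mod_eq_of_lt hi]
  have hpL : pathVertex s L = g' := by
    have := pathVertex_add s 0 L
    rw [hseg, hwg] at this
    simpa [pathVertex] using this
  have hconj : ∀ i, IsConj g ((pathVertex s i)⁻¹ * pathVertex s (i + L)) := by
    intro i
    rw [pathVertex_add_period hper, hpL]
    refine hgg'.trans (isConj_iff.mpr ⟨(pathVertex s i)⁻¹, by group⟩)
  obtain ⟨n, hn, hgn⟩ := isOfFinOrder_iff_pow_eq_one.mp hfin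
  have hle : ∀ i m, wdist H X (pathVertex s i) (pathVertex s (i + m)) ≤ m := by
    intro i m
    rw [pathVertex_add]
    simpa using wdist_mul_word (pathVertex s i) (segment s i m)
  have hn' : ∀ g'', IsConj g g'' → g'' ^ n = 1 := by
    intro g'' h
    have := IsConj.pow n h
    rw [hgn] at this
    exact isConj_one_right.mp this
  refine ⟨s, L, n, ⟨hpos, hn, hper, hn' _ (hpL ▸ hgg'), ?_, ?_⟩, hpL ▸ hgg'⟩
  · intro i m hm
    refine (hle i m).antisymm ?_
    have h1 := hmin _ (hconj i)
    have h2 := wdist_triangle hs (pathVertex s i) (pathVertex s (i + m)) (pathVertex s (i + L))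
    have h3 := hle (i + m) (L - m)
    rw [add_assoc, Nat.add_sub_cancel' hm] at h3
    change L ≤ wdist H X (pathVertex s i) (pathVertex s (i + L)) at h1
    omega
  · intro i l hmem
    refine htf l _ hmem ?_ (isOfFinOrder_iff_pow_eq_one.mpr ⟨n, hn, hn' _ (hconj i)⟩)
    intro h1
    have := hconj i
    rw [h1] at this
    exact hg (isConj_one_left.mp this)

end RelHyp
namespace RelHyp

open scoped Pointwise

variable {G : Type*} [Group G] {Λ : Type*} {H : Λ → Subgroup G} {X : Set G}

theorem IsCocycle.abs_map_word_le {c : RelFree H X → G → ℤ} (hc : IsCocycle c)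
    (w : List (RelLetter H X)) (hw : ∀ s ∈ w, ∀ g, |c s.toF g| ≤ 1) (g : G) :
    |c (wordToF w) g| ≤ w.length := by
  induction w generalizing g with
  | nil => simp [hc.map_one]
  | cons s w ih =>
    rw [wordToF_cons, hc]
    have h1 := hw s (by simp) g
    have h2 := ih (fun t ht => hw t (by simp [ht])) (g * relEps H X s.toF)
    have h3 := abs_add_le (c s.toF g) (c (wordToF w) (g * relEps H X s.toF))
    push_cast [List.length_cons]
    linarith

/-! ### Truncated word lengths -/

/-- The length of `g` with respect to `S`, truncated at `M`. -/
noncomputable def truncLen (S : Set G) (M : ℕ) (g : G) : ℕ :=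
  sInf {n | n = M ∨ g ∈ S ^ n}

theorem truncLen_spec (S : Set G) (M : ℕ) (g : G) :
    truncLen S M g = M ∨ g ∈ S ^ truncLen S M g :=
  Nat.sInf_mem (s := {n | n = M ∨ g ∈ S ^ n}) ⟨M, Or.inl rfl⟩

theorem truncLen_le {S : Set G} {M n : ℕ} {g : G} (h : n = M ∨ g ∈ S ^ n) :
    truncLen S M g ≤ n :=
  Nat.sInf_le h

@[simp] theorem truncLen_one (S : Set G) (M : ℕ) : truncLen S M 1 = 0 :=
  Nat.le_zero.mp (truncLen_le (by simp))

theorem truncLen_mul_le (S : Set G) (M : ℕ) (g : G) {h : G} (hh : h ∈ S) :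
    truncLen S M (g * h) ≤ truncLen S M g + 1 := by
  rcases truncLen_spec S M g with h1 | h1
  · exact (truncLen_le (Or.inl rfl)).trans (by omega)
  · exact truncLen_le (Or.inr (pow_succ S _ ▸ Set.mul_mem_mul h1 hh))

theorem mem_pow_of_truncLen_lt {S : Set G} (h1 : 1 ∈ S) {M n : ℕ} {g : G}
    (hn : truncLen S M g ≤ n) (hM : n < M) : g ∈ S ^ n := by
  rcases truncLen_spec S M g with h | h
  · omega
  · exact Set.pow_subset_pow_right h1 hn h

/-- The identity, the elements of `H l` that occur as letters in `T`, and their inverses. -/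
def letterSet (T : Set (RelLetter H X)) (l : Λ) : Set G :=
  {g | g = 1 ∨ ∃ h : {h : H l // h ≠ 1},
    (Sum.inl ⟨l, h⟩ : RelLetter H X) ∈ T ∧ (g = h.1 ∨ g = (h.1 : G)⁻¹)}

theorem one_mem_letterSet (T : Set (RelLetter H X)) (l : Λ) : (1 : G) ∈ letterSet T l :=
  Or.inl rfl

theorem finite_letterSet {T : Set (RelLetter H X)} (hT : T.Finite) (l : Λ) :
    (letterSet T l).Finite := by
  refine ((Set.finite_singleton (1 : G)).union ((hT.image RelLetter.val).union
    (hT.image fun s => s.val⁻¹))).subset ?_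
  rintro g (rfl | ⟨h, hh, rfl | rfl⟩)
  · exact Or.inl rfl
  · exact Or.inr (Or.inl ⟨_, hh, rfl⟩)
  · exact Or.inr (Or.inr ⟨_, hh, rfl⟩)

theorem finite_pow {S : Set G} (hS : S.Finite) (n : ℕ) : (S ^ n).Finite := by
  induction n with
  | zero => simp
  | succ n ih =>
    rw [pow_succ]
    exact ih.mul hS

theorem finite_letters_of_pow {T : Set (RelLetter H X)} (hT : T.Finite) (hX : X.Finite)
    (C : ℕ) :
    {s : RelLetter H X | ∀ l h, s = Sum.inl ⟨l, h⟩ → (h.1 : G) ∈ letterSet T l ^ C}.Finite := by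
  have : Finite X := hX
  have hfin : (⋃ l ∈ {l | ∃ s ∈ T, s.hIndex = some l},
      (fun h : {h : H l // h ≠ 1} => (Sum.inl ⟨l, h⟩ : RelLetter H X)) ''
        ((fun h : {h : H l // h ≠ 1} => (h.1 : G)) ⁻¹' (letterSet T l ^ C))).Finite := by
    refine Set.Finite.biUnion ?_ fun l _ => Set.Finite.image _ ?_
    · refine Set.Finite.of_finite_image (f := some) ((hT.image RelLetter.hIndex).subset ?_)
        (Option.some_injective _).injOn
      rintro _ ⟨l, ⟨s, hs, hl⟩, rfl⟩
      exact ⟨s, hs, hl⟩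
    · exact (finite_pow (finite_letterSet hT l) C).preimage
        (Subtype.val_injective.comp Subtype.val_injective).injOn
  refine (hfin.union (Set.finite_range (Sum.inr : X × Bool → RelLetter H X))).subset ?_
  rintro (⟨l, h⟩ | x) hs
  · refine Or.inl (Set.mem_biUnion (x := l) ?_ ⟨h, hs l h rfl, rfl⟩)
    by_contra hl
    have hsub : letterSet T l ⊆ 1 := by
      rintro g (rfl | ⟨h', hh', -⟩)
      · rfl
      · exact absurd ⟨_, hh', rfl⟩ hl
    have h1 := Set.pow_subset_pow_left (n := C) hsub (hs l h rfl)
    rw [one_pow, Set.mem_one] at h1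
    exact h.2 (Subtype.ext h1)
  · exact Or.inr ⟨x, rfl⟩

/-! ### Bounding the parabolic letters of a cyclic geodesic -/

section Letters

variable {R : Set (RelFree H X)} {A B ℓ : ℕ} {wd : RelFree H X → List (RelLetter H X)}

theorem exists_shift_period {s : ℕ → RelLetter H X} {L : ℕ} (hL : 0 < L)
    (h : ∀ k, s (k + L) = s k) (k i : ℕ) : ∃ t < L, s (i + t) = s k := by
  refine ⟨(k + i * L - i) % L, Nat.mod_lt _ hL, ?_⟩
  have hi : i ≤ k + i * L := (Nat.le_mul_of_pos_right i hL).trans (Nat.le_add_left _ _)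
  rw [← letter_add_mul_period h k i, ← letter_add_mul_period h _ ((k + i * L - i) / L), add_assoc,
    Nat.mod_add_div', Nat.add_sub_cancel' hi]

/-- Two letters of the path from the same `H l` whose origins lie in the same coset of `H l`, at
minimal positive distance along the path, are more than a period apart. -/
theorem IsCyclicGeodesic.exists_minimal_connected {s : ℕ → RelLetter H X} {L n : ℕ}
    (h : IsCyclicGeodesic s L n) {k₁ : ℕ} {l₁ : Λ} (hk₁ : (s k₁).hIndex = some l₁) :
    ∃ m k l, L < m ∧ (s k).hIndex = some l ∧ (s (k + m)).hIndex = some l ∧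
      (pathVertex s k)⁻¹ * pathVertex s (k + m) ∈ H l ∧
      ∀ i j l', i < j → j < i + m → (s i).hIndex = some l' → (s j).hIndex = some l' →
        (pathVertex s i)⁻¹ * pathVertex s j ∉ H l' := by
  classical
  have hex : ∃ m, 0 < m ∧ ∃ k l, (s k).hIndex = some l ∧ (s (k + m)).hIndex = some l ∧
      (pathVertex s k)⁻¹ * pathVertex s (k + m) ∈ H l := by
    refine ⟨n * L, Nat.mul_pos h.pos_mul h.pos, k₁, l₁, hk₁, ?_, ?_⟩
    · rw [letter_add_mul_period h.periodic, hk₁]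
    · rw [h.pathVertex_closed, inv_mul_cancel]
      exact one_mem _
  obtain ⟨hm, k, l, hk, hkm, hmem⟩ := Nat.find_spec hex
  refine ⟨Nat.find hex, k, l, ?_, hk, hkm, hmem, ?_⟩
  · by_contra! hle
    rcases hle.lt_or_eq with hlt | heq
    · have h1 : (pathVertex s k)⁻¹ * pathVertex s (k + (Nat.find hex + 1)) ∈ H l := by
        rw [← add_assoc, pathVertex, ← mul_assoc]
        refine mul_mem hmem ?_
        revert hkm
        rcases s (k + Nat.find hex) with ⟨l', a⟩ | x
        · simp only [RelLetter.hIndex, Option.some.injEq]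
          rintro rfl
          exact a.1.2
        · simp [RelLetter.hIndex]
      have h2 : wdist H X _ _ ≤ 1 := minLen_le_one_of_mem h1
      rw [h.geodesic k _ hlt] at h2
      omega
    · rw [heq] at hmem
      exact h.not_mem k l hmem
  · intro i j l' hij hj hi hj' hmem'
    refine Nat.find_min hex (m := j - i) (by omega) ⟨by omega, i, l', hi, ?_, ?_⟩
    · rwa [Nat.add_sub_cancel' hij.le]
    · rwa [Nat.add_sub_cancel' hij.le]

theorem IsCyclicGeodesic.truncLen_le (hp : IsFiniteRelPres H X R)
    (hf : IsIsoperFn H X R fun n => A * n + B)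
    (hwd : ∀ r ∈ R, wordToF (wd r) = r ∧ (wd r).length ≤ ℓ)
    {s : ℕ → RelLetter H X} {L n : ℕ} (h : IsCyclicGeodesic s L n) {k₁ : ℕ} {l₁ : Λ}
    {a₁ : {a : H l₁ // a ≠ 1}} (hk₁ : s k₁ = Sum.inl ⟨l₁, a₁⟩) (M : ℕ) :
    truncLen (letterSet {t | ∃ r ∈ R, t ∈ wd r} l₁) M a₁.1 ≤ ℓ * (2 * A * L + B) := by
  classical
  set T : Set (RelLetter H X) := {t | ∃ r ∈ R, t ∈ wd r} with hT
  obtain ⟨m, k, l, hLm, hk, hkm, hmem, hmin⟩ :=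
    h.exists_minimal_connected (k₁ := k₁) (l₁ := l₁) (by rw [hk₁]; rfl)
  obtain ⟨m, rfl⟩ : ∃ m', m = m' + 1 := ⟨m - 1, by omega⟩
  set p := pathVertex s with hpdef
  let base : ∀ l', G ⧸ H l' → G := fun l' Q =>
    if hQ : ∃ t < m + 1, (s (k + 1 + t)).hIndex = some l' ∧ (p (k + 1 + t) : G ⧸ H l') = Q then
      p (k + 1 + hQ.choose) else 1
  have hbase : ∀ l' t, t < m + 1 → (s (k + 1 + t)).hIndex = some l' →
      base l' (p (k + 1 + t)) = p (k + 1 + t) := by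
    intro l' t ht hidx
    have hQ : ∃ t' < m + 1, (s (k + 1 + t')).hIndex = some l' ∧
        (p (k + 1 + t') : G ⧸ H l') = p (k + 1 + t) := ⟨t, ht, hidx, rfl⟩
    have hb : base l' (p (k + 1 + t)) = p (k + 1 + hQ.choose) := dif_pos hQ
    obtain ⟨h1, h2, h3⟩ := hQ.choose_spec
    rw [hb]
    revert h1 h2 h3
    generalize hQ.choose = t'
    intro h1 h2 h3
    rcases lt_trichotomy t' t with hlt | rfl | hlt
    · exact absurd (QuotientGroup.eq.mp h3) (hmin _ _ l' (by omega) (by omega) h2 hidx)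
    · rfl
    · exact absurd (QuotientGroup.eq.mp h3.symm) (hmin _ _ l' (by omega) (by omega) hidx h2)
  let Φ : Λ → G → ℤ := fun l' g =>
    (truncLen (letterSet T l') M ((base l' (g : G ⧸ H l'))⁻¹ * g) : ℕ)
  obtain ⟨c, hc, hcH, hcX⟩ := exists_cocycle (H := H) (X := X) Φ fun _ _ => 0
  have hΦ : ∀ l' (a : H l') g, Φ l' (g * a) =
      (truncLen (letterSet T l') M ((base l' (g : G ⧸ H l'))⁻¹ * g * a) : ℕ) := by
    intro l' a g
    have : ((g * a : G) : G ⧸ H l') = g := (QuotientGroup.mk_mul_of_mem g a.2)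
    simp only [Φ, this, mul_assoc]
  have hcinr : ∀ x g, c (RelLetter.toF (Sum.inr x)) g = 0 := by
    rintro ⟨x, b⟩ g
    cases b
    · simp [RelLetter.toF, hc.map_inv, hcX]
    · simp [RelLetter.toF, hcX]
  have hcT : ∀ t ∈ T, ∀ g, |c t.toF g| ≤ 1 := by
    rintro (⟨l', a⟩ | x) ht g
    · have h1 : (a.1 : G) ∈ letterSet T l' := Or.inr ⟨a, ht, Or.inl rfl⟩
      have h2 : (a.1 : G)⁻¹ ∈ letterSet T l' := Or.inr ⟨a, ht, Or.inr rfl⟩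
      have h3 := truncLen_mul_le _ M ((base l' (g : G ⧸ H l'))⁻¹ * g) h1
      have h4 := truncLen_mul_le _ M ((base l' (g : G ⧸ H l'))⁻¹ * g * a.1) h2
      rw [mul_inv_cancel_right] at h4
      rw [RelLetter.toF, hcH, hΦ, abs_le]
      simp only [Φ]
      omega
    · simp [hcinr]
  have hcR : ∀ r ∈ R, ∀ g, c r g ≤ ℓ := by
    intro r hr g
    obtain ⟨h1, h2⟩ := hwd r hr
    have h3 := hc.abs_map_word_le (wd r) (fun t ht => hcT t ⟨r, hr, ht⟩) g
    rw [h1] at h3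
    exact (le_abs_self _).trans (h3.trans (by exact_mod_cast h2))
  have hτ : ∀ t < m + 1, ∀ l' a, s (k + 1 + t) = Sum.inl ⟨l', a⟩ →
      c (s (k + 1 + t)).toF (p (k + 1 + t)) = truncLen (letterSet T l') M a.1 := by
    intro t ht l' a hs
    have h1 := hbase l' t ht (by rw [hs]; rfl)
    rw [hs, RelLetter.toF, hcH, hΦ]
    simp only [Φ]
    simp [h1]
  have hτ0 : ∀ t < m + 1, 0 ≤ c (s (k + 1 + t)).toF (p (k + 1 + t)) := by
    intro t ht
    rcases hs : s (k + 1 + t) with ⟨l', a⟩ | x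
    · rw [← hs, hτ t ht l' a hs]
      exact Int.natCast_nonneg _
    · rw [hcinr]
  have hkm' : k + (m + 1) = k + 1 + m := by ring
  rw [hkm'] at hkm hmem
  have hv : (p (k + 1 + m))⁻¹ * p (k + 1) ∈ H l := by
    have h1 : (p k)⁻¹ * p (k + 1) ∈ H l := by
      rw [hpdef, pathVertex, inv_mul_cancel_left]
      revert hk
      rcases s k with ⟨l', a⟩ | x
      · simp only [RelLetter.hIndex, Option.some.injEq]
        rintro rfl
        exact a.1.2
      · simp [RelLetter.hIndex]
    have := mul_mem (inv_mem hmem) h1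
    rwa [mul_inv_rev, inv_inv, mul_assoc, mul_inv_cancel_left] at this
  obtain ⟨v, hvlen, hvF⟩ := exists_word_of_mem (X := X) (⟨_, hv⟩ : H l)
  have hpm : p (k + 1) * relEps H X (wordToF (segment s (k + 1) m)) = p (k + 1 + m) :=
    (pathVertex_add s (k + 1) m).symm
  have hvε : relEps H X (wordToF v) = (p (k + 1 + m))⁻¹ * p (k + 1) := by
    simp [hvF, relEps]
  obtain ⟨N, hN, r, b, hr, hsum⟩ := exists_relators hp hf (segment s (k + 1) m ++ v) (by
    rw [wordToF_append, map_mul, hvε, ← hpm]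
    group) (p (k + 1))
  have hupper : c (wordToF (segment s (k + 1) m ++ v)) (p (k + 1)) ≤ N * ℓ := by
    rw [hsum c hc]
    simpa using Finset.sum_le_card_nsmul Finset.univ (fun i => c (r i) (b i)) (ℓ : ℤ)
      fun i _ => hcR _ (hr i) _
  have hlower : ∑ t ∈ Finset.range m, c (s (k + 1 + t)).toF (p (k + 1 + t)) ≤
      c (wordToF (segment s (k + 1) m ++ v)) (p (k + 1)) := by
    rw [wordToF_append, hc, hc.map_segment, hpm, hvF, hcH]
    have h0 : Φ l (p (k + 1 + m)) = 0 := by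
      simp only [Φ, hbase l m (by omega) hkm]
      simp
    have h1 : 0 ≤ Φ l (p (k + 1 + m) * ((p (k + 1 + m))⁻¹ * p (k + 1))) := Int.natCast_nonneg _
    rw [h0]
    linarith
  obtain ⟨t₀, ht₀, hst₀⟩ := exists_shift_period h.pos h.periodic k₁ (k + 1)
  set Q := m / L with hQ
  have hQpos : 0 < Q := Nat.div_pos (by omega) h.pos
  have hQm : m < (Q + 1) * L := by
    rw [mul_comm]
    exact Nat.lt_mul_div_succ m h.pos
  have hmQ : Q * L ≤ m := Nat.div_mul_le_self m L
  have hcount : (Q : ℤ) * truncLen (letterSet T l₁) M a₁.1 ≤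
      ∑ t ∈ Finset.range m, c (s (k + 1 + t)).toF (p (k + 1 + t)) := by
    have hinj : Set.InjOn (fun u => t₀ + u * L) (Finset.range Q : Set ℕ) := by
      intro u _ u' _ huu
      exact Nat.eq_of_mul_eq_mul_right h.pos (Nat.add_left_cancel huu)
    have hsub : (Finset.range Q).image (fun u => t₀ + u * L) ⊆ Finset.range m := by
      intro t ht
      simp only [Finset.mem_image, Finset.mem_range] at ht ⊢
      obtain ⟨u, hu, rfl⟩ := ht
      have : (u + 1) * L ≤ Q * L := Nat.mul_le_mul_right L hu
      nlinarith
    refine le_trans ?_ (Finset.sum_le_sum_of_subset_of_nonneg hsub fun t ht _ =>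
      hτ0 t (by simp only [Finset.mem_range] at ht; omega))
    rw [Finset.sum_image hinj]
    refine le_of_eq ?_
    rw [Finset.sum_congr rfl (g := fun _ => (truncLen (letterSet T l₁) M a₁.1 : ℤ))]
    · simp
    · intro u hu
      have hu' := Finset.mem_range.mp (hsub (Finset.mem_image_of_mem _ hu))
      refine hτ _ (by omega) _ _ ?_
      rw [← add_assoc, letter_add_mul_period h.periodic, hst₀, hk₁]
  have hN' : N ≤ A * (m + 1) + B := by
    refine hN.trans ?_
    simp only [List.length_append, length_segment]
    gcongr
  have hfinal : Q * truncLen (letterSet T l₁) M a₁.1 ≤ N * ℓ := by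
    exact_mod_cast hcount.trans (hlower.trans hupper)
  refine Nat.le_of_mul_le_mul_left ?_ hQpos
  have h1 : m + 1 ≤ 2 * Q * L := by nlinarith
  have h2 : A * (m + 1) + B ≤ Q * (2 * A * L + B) := by nlinarith
  calc _ ≤ N * ℓ := hfinal
    _ ≤ Q * (2 * A * L + B) * ℓ := Nat.mul_le_mul_right ℓ (hN'.trans h2)
    _ = _ := by ring

theorem exists_finite_letters (hp : IsFiniteRelPres H X R)
    (hf : IsIsoperFn H X R fun n => A * n + B) (L₀ : ℕ) :
    ∃ Y : Set (RelLetter H X), Y.Finite ∧ ∀ (s : ℕ → RelLetter H X) (L n : ℕ),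
      IsCyclicGeodesic s L n → L ≤ L₀ → ∀ k, s k ∈ Y := by
  obtain ⟨wd, ℓ, hwd⟩ := hp.exists_words
  have hT : {t | ∃ r ∈ R, t ∈ wd r}.Finite := by
    have : {t | ∃ r ∈ R, t ∈ wd r} = ⋃ r ∈ R, {t | t ∈ wd r} := by ext; simp
    rw [this]
    exact hp.finR.biUnion fun r _ => List.finite_toSet (wd r)
  refine ⟨_, finite_letters_of_pow hT hp.finX (ℓ * (2 * A * L₀ + B)), ?_⟩
  intro s L n h hL k l a hk
  refine mem_pow_of_truncLen_lt (one_mem_letterSet _ l)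
    ((h.truncLen_le hp hf hwd hk (ℓ * (2 * A * L₀ + B) + 1)).trans ?_) (Nat.lt_succ_self _)
  gcongr

end Letters

end RelHyp
namespace RelHyp

variable {G : Type*} [Group G] {Λ : Type*} {H : Λ → Subgroup G} {X : Set G}

/-! ### Bounding the length of a cyclic geodesic -/

theorem cast_tsub_le_wdist (hs : Function.Surjective (relEps H X)) (ρ : ℕ) (a u v : G) :
    |((ρ - wdist H X a u : ℕ) : ℤ) - ((ρ - wdist H X a v : ℕ) : ℤ)| ≤ wdist H X u v := by
  have h1 := wdist_triangle hs a u v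
  have h2 := wdist_triangle hs a v u
  rw [wdist_comm hs v u] at h2
  rw [abs_le]
  omega

/-- A discrete analogue of the one-form `ψ df`, where `ψ = max (0, ρ - d(a, ·))` and
`f = d(b, ·)`. -/
theorem exists_bump_cocycle (a b : G) (ρ : ℕ) :
    ∃ c : RelFree H X → G → ℤ, IsCocycle c ∧ ∀ (t : RelLetter H X) g,
      ∃ u, wdist H X g u ≤ 1 ∧ c t.toF g = ((ρ - wdist H X a u : ℕ) : ℤ) *
        ((wdist H X b (g * t.val) : ℤ) - wdist H X b g) := by
  classical
  obtain ⟨c, hc, hcH, hcX⟩ := exists_cocycle (H := H) (X := X)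
    (fun l g => ((ρ - wdist H X a (g : G ⧸ H l).out : ℕ) : ℤ) * wdist H X b g)
    (fun x g => ((ρ - wdist H X a g : ℕ) : ℤ) *
        ((wdist H X b (g * x) : ℤ) - wdist H X b g))
  refine ⟨c, hc, ?_⟩
  rintro (⟨l, h⟩ | ⟨x, e⟩) g
  · refine ⟨(g : G ⧸ H l).out, minLen_le_one_of_mem (l := l) ?_, ?_⟩
    · rw [← QuotientGroup.eq, QuotientGroup.out_eq']
    · have : ((g * h.1 : G) : G ⧸ H l) = g := QuotientGroup.mk_mul_of_mem g h.1.2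
      rw [RelLetter.toF, hcH, this, RelLetter.val]
      ring
  · cases e
    · refine ⟨g * (x : G)⁻¹, ?_, ?_⟩
      · simpa [RelLetter.val] using wdist_mul_val g (Sum.inr (x, false) : RelLetter H X)
      · have hx : relEps H X (Monoid.Coprod.inr (FreeGroup.of x)) = x := by simp [relEps]
        simp only [RelLetter.toF, RelLetter.val, Bool.false_eq_true, if_false, map_inv]
        rw [hc.map_inv, hx, hcX, inv_mul_cancel_right]
        ring
    · exact ⟨g, by simp, by simp [RelLetter.toF, RelLetter.val, hcX]⟩

section Bump

variable {c : RelFree H X → G → ℤ} {a b : G} {ρ : ℕ}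

/-- If a bump one-form does not vanish on a path, the path passes close to the centre of the
bump. -/
theorem IsCocycle.exists_near_of_ne_zero (hs : Function.Surjective (relEps H X))
    (hc : IsCocycle c)
    (hbump : ∀ (t : RelLetter H X) g, ∃ u, wdist H X g u ≤ 1 ∧
      c t.toF g = ((ρ - wdist H X a u : ℕ) : ℤ) *
        ((wdist H X b (g * t.val) : ℤ) - wdist H X b g))
    (w : List (RelLetter H X)) (g : G) (hne : c (wordToF w) g ≠ 0) :
    ∃ m ≤ w.length, wdist H X a g ≤ ρ + m ∧
      wdist H X a (g * relEps H X (wordToF w)) ≤ ρ + (w.length - m) := by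
  induction w generalizing g with
  | nil => exact absurd (hc.map_one g) hne
  | cons s w ih =>
    by_cases h0 : c (wordToF w) (g * s.val) = 0
    · rw [wordToF_cons, hc, relEps_toF, h0, add_zero] at hne
      obtain ⟨u, hu, hcu⟩ := hbump s g
      rw [hcu] at hne
      have h1 : (ρ - wdist H X a u : ℕ) ≠ 0 := by
        intro h
        exact hne (by rw [h]; simp)
      have h2 := wdist_triangle hs a u g
      rw [wdist_comm hs u g] at h2
      have h3 := wdist_triangle hs a g (g * relEps H X (wordToF (s :: w)))
      have h4 := wdist_mul_word g (s :: w)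
      exact ⟨0, by simp, by omega, by omega⟩
    · obtain ⟨m, hm, h1, h2⟩ := ih _ h0
      have h3 := wdist_triangle hs a (g * s.val) g
      rw [wdist_comm hs (g * s.val) g] at h3
      have h4 := wdist_mul_val g s
      refine ⟨m + 1, by simpa using hm, by omega, ?_⟩
      rw [wordToF_cons, map_mul, relEps_toF, ← mul_assoc, List.length_cons, Nat.add_sub_add_right]
      exact h2

/-- The difference between a bump one-form `ψ df` and the exact one-form `ψ(g) df` is quadratic in
the length of the path. -/
theorem IsCocycle.abs_bump_sub_le (hs : Function.Surjective (relEps H X)) (hc : IsCocycle c)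
    (hbump : ∀ (t : RelLetter H X) g, ∃ u, wdist H X g u ≤ 1 ∧
      c t.toF g = ((ρ - wdist H X a u : ℕ) : ℤ) *
        ((wdist H X b (g * t.val) : ℤ) - wdist H X b g))
    (w : List (RelLetter H X)) (g : G) :
    |c (wordToF w) g - ((ρ - wdist H X a g : ℕ) : ℤ) *
      ((wdist H X b (g * relEps H X (wordToF w)) : ℤ) - wdist H X b g)| ≤
        (w.length : ℤ) ^ 2 := by
  have hlip : ∀ g (v : List (RelLetter H X)),
      |(wdist H X b (g * relEps H X (wordToF v)) : ℤ) - wdist H X b g| ≤ v.length := by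
    intro g v
    have h1 := wdist_triangle hs b g (g * relEps H X (wordToF v))
    have h2 := wdist_triangle hs b (g * relEps H X (wordToF v)) g
    rw [wdist_comm hs (g * relEps H X (wordToF v)) g] at h2
    have h3 := wdist_mul_word g v
    rw [abs_le]
    omega
  induction w generalizing g with
  | nil => simp [hc.map_one]
  | cons s w ih =>
    obtain ⟨u, hu, hcu⟩ := hbump s g
    have h1 := ih (g * s.val)
    have h2 := hlip (g * s.val) w
    have h3 : |(wdist H X b (g * s.val) : ℤ) - wdist H X b g| ≤ 1 := by simpa using hlip g [s]
    have h4 := cast_tsub_le_wdist hs ρ a u g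
    rw [wdist_comm hs u g] at h4
    have h5 := cast_tsub_le_wdist hs ρ a (g * s.val) g
    rw [wdist_comm hs (g * s.val) g] at h5
    have h6 : (wdist H X g (g * s.val) : ℤ) ≤ 1 := by exact_mod_cast wdist_mul_val g s
    have hu' : (wdist H X g u : ℤ) ≤ 1 := by exact_mod_cast hu
    rw [wordToF_cons, hc, map_mul, relEps_toF, hcu, ← mul_assoc]
    generalize ((ρ - wdist H X a u : ℕ) : ℤ) = ψu at *
    generalize ((ρ - wdist H X a g : ℕ) : ℤ) = ψg at *
    generalize ((ρ - wdist H X a (g * s.val) : ℕ) : ℤ) = ψs at *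
    generalize (wdist H X b (g * s.val * relEps H X (wordToF w)) : ℤ) = fw at *
    generalize (wdist H X b (g * s.val) : ℤ) = fs at *
    generalize (wdist H X b g : ℤ) = fg at *
    generalize c (wordToF w) (g * s.val) = cw at *
    have h7 : |(ψu - ψg) * (fs - fg)| ≤ 1 * 1 := by
      rw [abs_mul]
      exact mul_le_mul (h4.trans hu') h3 (abs_nonneg _) zero_le_one
    have h8 : |(ψs - ψg) * (fw - fs)| ≤ 1 * w.length := by
      rw [abs_mul]
      exact mul_le_mul (h5.trans h6) h2 (abs_nonneg _) zero_le_one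
    have heq : ψu * (fs - fg) + cw - ψg * (fw - fg) =
        (ψu - ψg) * (fs - fg) + (ψs - ψg) * (fw - fs) + (cw - ψs * (fw - fs)) := by ring
    rw [heq, List.length_cons]
    refine (abs_add_three _ _ _).trans ?_
    push_cast
    nlinarith

end Bump

/-- The sum of a nonnegative quantity along a path segment near the centre of a bump. -/
theorem sq_le_sum_of_bump {σ m t₀ : ℕ} {τ : ℕ → ℤ} (hτ : ∀ t < m, 0 ≤ τ t) (ht₀ : t₀ + σ ≤ m)
    (h : ∀ t < σ, (σ : ℤ) ≤ τ (t₀ + t)) : (σ : ℤ) ^ 2 ≤ ∑ t ∈ Finset.range m, τ t := by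
  have hsub : (Finset.range σ).image (fun t => t₀ + t) ⊆ Finset.range m := by
    intro t ht
    simp only [Finset.mem_image, Finset.mem_range] at ht ⊢
    omega
  refine le_trans ?_ (Finset.sum_le_sum_of_subset_of_nonneg hsub fun t ht _ =>
    hτ t (Finset.mem_range.mp ht))
  rw [Finset.sum_image (by intro _ _ _ _ h; exact Nat.add_left_cancel h)]
  have := Finset.card_nsmul_le_sum (Finset.range σ) (fun t => τ (t₀ + t)) (σ : ℤ)
    fun t ht => h t (Finset.mem_range.mp ht)
  simpa [sq] using this

end RelHyp
namespace RelHyp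

variable {G : Type*} [Group G] {Λ : Type*} {H : Λ → Subgroup G} {X : Set G}

/-- A subpath whose endpoints are close to each other, although it is long, and which is minimal
with this property. -/
theorem IsCyclicGeodesic.exists_minimal_close {s : ℕ → RelLetter H X} {L n D : ℕ}
    (h : IsCyclicGeodesic s L n) (hD : D < L) :
    ∃ m i, L < m ∧ wdist H X (pathVertex s i) (pathVertex s (i + m)) ≤ D ∧
      ∀ x y, x + D < y → y < x + m → D < wdist H X (pathVertex s x) (pathVertex s y) := by
  classical
  have hex : ∃ m, D < m ∧ ∃ i, wdist H X (pathVertex s i) (pathVertex s (i + m)) ≤ D := by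
    refine ⟨n * L, hD.trans_le (Nat.le_mul_of_pos_left L h.pos_mul), 0, ?_⟩
    rw [h.pathVertex_closed, wdist_self]
    exact Nat.zero_le _
  obtain ⟨hm, i, hi⟩ := Nat.find_spec hex
  refine ⟨Nat.find hex, i, ?_, hi, ?_⟩
  · by_contra! hle
    rw [h.geodesic i _ hle] at hi
    omega
  · intro x y hxy hy
    by_contra! hle
    refine Nat.find_min hex (m := y - x) (by omega) ⟨by omega, x, ?_⟩
    rwa [Nat.add_sub_cancel' (by omega)]

/-- The values of a bump one-form centred at the `a`-th vertex of a cyclic geodesic, along a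
subpath which returns close to that vertex only near the index `a`. -/
theorem IsCyclicGeodesic.bump_letter (hs : Function.Surjective (relEps H X))
    {s : ℕ → RelLetter H X} {L n : ℕ} (h : IsCyclicGeodesic s L n) {a ρ q : ℕ}
    {c : RelFree H X → G → ℤ} (ha : 2 * ρ ≤ a) (hL : 3 * ρ + 1 ≤ L)
    (hbump : ∀ (t : RelLetter H X) g, ∃ u, wdist H X g u ≤ 1 ∧
      c t.toF g = ((ρ - wdist H X (pathVertex s a) u : ℕ) : ℤ) *
        ((wdist H X (pathVertex s (a - 2 * ρ)) (g * t.val) : ℤ) -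
          wdist H X (pathVertex s (a - 2 * ρ)) g))
    (hq : wdist H X (pathVertex s a) (pathVertex s q) ≤ ρ → a ≤ q + ρ ∧ q ≤ a + ρ) :
    0 ≤ c (s q).toF (pathVertex s q) ∧
      ((ρ : ℤ) - wdist H X (pathVertex s a) (pathVertex s q) - 1 ≤
        c (s q).toF (pathVertex s q)) := by
  obtain ⟨u, hu, hcu⟩ := hbump (s q) (pathVertex s q)
  rw [hcu]
  have h1 := wdist_triangle hs (pathVertex s a) u (pathVertex s q)
  have h2 := wdist_triangle hs (pathVertex s a) (pathVertex s q) u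
  rw [wdist_comm hs u (pathVertex s q)] at h1
  by_cases hclose : wdist H X (pathVertex s a) (pathVertex s q) ≤ ρ
  · obtain ⟨hq1, hq2⟩ := hq hclose
    have h3 := h.geodesic (a - 2 * ρ) (q - (a - 2 * ρ)) (by omega)
    have h4 := h.geodesic (a - 2 * ρ) (q + 1 - (a - 2 * ρ)) (by omega)
    rw [Nat.add_sub_cancel' (by omega)] at h3 h4
    rw [pathVertex] at h4
    have h5 : ((wdist H X (pathVertex s (a - 2 * ρ)) (pathVertex s q * (s q).val) : ℤ) -
        wdist H X (pathVertex s (a - 2 * ρ)) (pathVertex s q)) = 1 := by omega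
    rw [h5, mul_one]
    omega
  · have h0 : ρ - wdist H X (pathVertex s a) u = 0 := by omega
    rw [h0]
    simp
    omega

theorem exists_length_bound {R : Set (RelFree H X)} {A B : ℕ} (hp : IsFiniteRelPres H X R)
    (hf : IsIsoperFn H X R fun n => A * n + B) :
    ∃ L₀ : ℕ, ∀ (s : ℕ → RelLetter H X) (L n : ℕ), IsCyclicGeodesic s L n → L ≤ L₀ := by
  classical
  obtain ⟨wd, ℓ, hwd⟩ := hp.exists_words
  have hs := hp.surj
  obtain ⟨σ, hσ⟩ : ∃ σ, σ = 30 * ℓ ^ 2 * (2 * A + B) + ℓ + 1 := ⟨_, rfl⟩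
  obtain ⟨ρ, hρ⟩ : ∃ ρ, ρ = 2 * σ := ⟨_, rfl⟩
  have hσℓ : ℓ < σ := by
    rw [hσ]
    omega
  refine ⟨10 * ρ, fun s L n h => ?_⟩
  by_contra! hL
  obtain ⟨m, i, hLm, hi, hfar⟩ := h.exists_minimal_close (D := 4 * ρ) (by omega)
  set p := pathVertex s with hpdef
  have hnear : ∀ x y, i ≤ x → x ≤ y → y < x + m →
      wdist H X (p x) (p y) ≤ ρ → y ≤ x + ρ := by
    intro x y _ hxy hy hd
    by_cases hyL : y ≤ x + L
    · have := h.geodesic x (y - x) (by omega)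
      rw [Nat.add_sub_cancel' hxy] at this
      change wdist H X (p x) (p y) = y - x at this
      omega
    · have := hfar x y (by omega) hy
      omega
  obtain ⟨v, hv, hvε⟩ := exists_word_minLen hs ((p (i + m))⁻¹ * p i)
  have hv4 : v.length ≤ 4 * ρ := by
    rw [hv]
    change wdist H X (p (i + m)) (p i) ≤ _
    rwa [wdist_comm hs]
  have hpm : p i * relEps H X (wordToF (segment s i m)) = p (i + m) := (pathVertex_add s i m).symm
  have hend : p (i + m) * relEps H X (wordToF v) = p i := by rw [hvε, mul_inv_cancel_left]
  obtain ⟨K, hK, r, b, hr, hsum⟩ := exists_relators hp hf (segment s i m ++ v) (by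
    rw [wordToF_append, map_mul, hvε, ← hpm]
    group) (p i)
  obtain ⟨N, hN⟩ : ∃ N, N + 1 = m / (5 * ρ) := by
    have : 0 < m / (5 * ρ) := Nat.div_pos (by omega) (by omega)
    exact ⟨m / (5 * ρ) - 1, by omega⟩
  have hN1 : (N + 1) * (5 * ρ) ≤ m := hN ▸ Nat.div_mul_le_self m (5 * ρ)
  have hN2 : m < (N + 2) * (5 * ρ) := by
    rw [mul_comm, show N + 2 = m / (5 * ρ) + 1 by omega]
    exact Nat.lt_mul_div_succ m (by omega)
  have hNpos : 0 < N := by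
    by_contra h0
    have : N = 0 := by omega
    subst this
    omega
  obtain ⟨a, ha⟩ : ∃ a : ℕ → ℕ, ∀ j, a j = i + (j + 1) * (5 * ρ) := ⟨_, fun _ => rfl⟩
  have ha1 : ∀ j, i + 5 * ρ ≤ a j := fun j => by
    rw [ha]
    nlinarith
  have ha2 : ∀ j < N, a j + 5 * ρ ≤ i + m := fun j hj => by
    have : (j + 2) * (5 * ρ) ≤ (N + 1) * (5 * ρ) := Nat.mul_le_mul_right _ (by omega)
    rw [ha]
    nlinarith
  have ha3 : ∀ j j', j < j' → a j + 5 * ρ ≤ a j' := fun j j' hj => by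
    have : (j + 2) * (5 * ρ) ≤ (j' + 1) * (5 * ρ) := Nat.mul_le_mul_right _ (by omega)
    rw [ha, ha]
    nlinarith
  choose c hc hbump using fun j =>
    exists_bump_cocycle (H := H) (X := X) (p (a j)) (p (a j - 2 * ρ)) ρ
  have hlower : ∀ j < N, (σ : ℤ) ^ 2 ≤ c j (wordToF (segment s i m ++ v)) (p i) := by
    intro j hj
    have h1 := ha1 j
    have h2 := ha2 j hj
    have hv0 : c j (wordToF v) (p (i + m)) = 0 := by
      by_contra hne
      obtain ⟨e, he, h3, h4⟩ := (hc j).exists_near_of_ne_zero hs (hbump j) v _ hne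
      rw [hend] at h4
      have h5 := hfar (a j) (i + m) (by omega) (by omega)
      have h6 := hfar i (a j) (by omega) (by omega)
      rw [wdist_comm hs] at h6
      omega
    rw [wordToF_append, hc, (hc j).map_segment, hpm, hv0, add_zero]
    have hletter : ∀ t < m, _ := fun t ht =>
      h.bump_letter hs (a := a j) (q := i + t) (by omega) (by omega) (hbump j) (by
        intro hd
        rcases le_total (a j) (i + t) with hle | hle
        · have := hnear (a j) (i + t) (by omega) hle (by omega) hd
          omega
        · rw [wdist_comm hs] at hd
          have := hnear (i + t) (a j) (by omega) hle (by omega) hd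
          omega)
    refine sq_le_sum_of_bump (t₀ := a j - i) (fun t ht => (hletter t ht).1) (by omega) ?_
    intro t ht
    have h3 := (hletter (a j - i + t) (by omega)).2
    have h4 := h.geodesic (a j) t (by omega)
    rw [← add_assoc, Nat.add_sub_cancel' (by omega : i ≤ a j)] at h3 ⊢
    rw [h4] at h3
    have h5 : (ρ : ℤ) = 2 * σ := by exact_mod_cast hρ
    have h6 : (t : ℤ) + 1 ≤ σ := by exact_mod_cast ht
    exact le_trans (by linarith) h3
  have hupper : ∀ x, ∑ j ∈ Finset.range N, c j (r x) (b x) ≤ (ℓ : ℤ) ^ 2 := by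
    intro x
    obtain ⟨hw1, hw2⟩ := hwd _ (hr x)
    have hclose : ∀ j, c j (r x) (b x) ≠ 0 → wdist H X (p (a j)) (b x) ≤ ρ + ℓ := by
      intro j hne
      rw [← hw1] at hne
      obtain ⟨e, he, h3, -⟩ := (hc j).exists_near_of_ne_zero hs (hbump j) _ _ hne
      omega
    by_cases hall : ∀ j ∈ Finset.range N, c j (r x) (b x) = 0
    · rw [Finset.sum_eq_zero hall]
      positivity
    · push Not at hall
      obtain ⟨j, hj, hne⟩ := hall
      have hdisj : ∀ j₁ j₂, j₁ < j₂ → j₂ < N → c j₁ (r x) (b x) ≠ 0 →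
          c j₂ (r x) (b x) = 0 := by
        intro j₁ j₂ hlt hj₂ hne₁
        by_contra hne₂
        have h1 := hclose _ hne₁
        have h2 := hclose _ hne₂
        have h3 := wdist_triangle hs (p (a j₁)) (b x) (p (a j₂))
        rw [wdist_comm hs (b x)] at h3
        have h4 := ha1 j₁
        have h5 := ha2 j₂ hj₂
        have h6 := ha3 j₁ j₂ hlt
        have h7 := hfar (a j₁) (a j₂) (by omega) (by omega)
        omega
      rw [Finset.sum_eq_single_of_mem j hj fun j' hj' hjj' => ?_]
      · have h1 := (hc j).abs_bump_sub_le hs (hbump j) (wd (r x)) (b x)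
        rw [hw1, hp.relEps_eq_one (hr x), mul_one, sub_self, mul_zero, sub_zero] at h1
        refine (le_abs_self _).trans (h1.trans ?_)
        gcongr
      · rw [Finset.mem_range] at hj hj'
        rcases lt_or_gt_of_ne hjj' with hlt | hlt
        · by_contra hne'
          exact hne (hdisj _ _ hlt hj hne')
        · exact hdisj _ _ hlt hj' hne
  have htotal : (N : ℤ) * σ ^ 2 ≤ K * ℓ ^ 2 := by
    calc (N : ℤ) * σ ^ 2 = ∑ j ∈ Finset.range N, (σ : ℤ) ^ 2 := by simp
      _ ≤ ∑ j ∈ Finset.range N, c j (wordToF (segment s i m ++ v)) (p i) :=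
        Finset.sum_le_sum fun j hj => hlower j (Finset.mem_range.mp hj)
      _ = ∑ x, ∑ j ∈ Finset.range N, c j (r x) (b x) := by
        rw [Finset.sum_comm]
        exact Finset.sum_congr rfl fun j _ => hsum _ (hc j)
      _ ≤ ∑ _x : Fin K, (ℓ : ℤ) ^ 2 := Finset.sum_le_sum fun x _ => hupper x
      _ = K * ℓ ^ 2 := by simp
  have htotal' : N * σ ^ 2 ≤ K * ℓ ^ 2 := by exact_mod_cast htotal
  have hK' : K ≤ (2 * A + B) * m := by
    refine hK.trans ?_
    simp only [List.length_append, length_segment]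
    have h1 : A * (m + v.length) ≤ A * (2 * m) := Nat.mul_le_mul_left A (by omega)
    have h2 : B ≤ B * m := Nat.le_mul_of_pos_right B (by omega)
    nlinarith
  have hm : m ≤ 30 * σ * N := by
    have : (N + 2) * (5 * ρ) ≤ 3 * N * (5 * ρ) := Nat.mul_le_mul_right _ (by omega)
    rw [hρ] at this hN2
    nlinarith
  have hle : (N * σ) * σ ≤ (N * σ) * (30 * ℓ ^ 2 * (2 * A + B)) :=
    calc (N * σ) * σ = N * σ ^ 2 := by ring
      _ ≤ K * ℓ ^ 2 := htotal'
      _ ≤ (2 * A + B) * (30 * σ * N) * ℓ ^ 2 :=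
        Nat.mul_le_mul_right _ (hK'.trans (Nat.mul_le_mul_left _ hm))
      _ = _ := by ring
  have := Nat.le_of_mul_le_mul_left hle (Nat.mul_pos hNpos (by omega))
  omega

/-- In a group that is hyperbolic relative to torsion-free subgroups, the nontrivial elements of
finite order form finitely many conjugacy classes. -/
theorem IsRelHyperbolic.exists_finite_conj (hhyp : IsRelHyperbolic H)
    (htf : ∀ l : Λ, ∀ h ∈ H l, h ≠ 1 → ¬ IsOfFinOrder h) :
    ∃ E : Set G, E.Finite ∧ ∀ g : G, g ≠ 1 → IsOfFinOrder g → ∃ e ∈ E, IsConj g e := by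
  obtain ⟨X, R, hp, A, B, hf⟩ := hhyp
  obtain ⟨L₀, hL₀⟩ := exists_length_bound hp hf
  obtain ⟨Y, hY, hYs⟩ := exists_finite_letters hp hf L₀
  have : Finite Y := hY
  refine ⟨(fun w : List Y => relEps H X (wordToF (w.map Subtype.val))) ''
    {w : List Y | w.length ≤ L₀}, (List.finite_length_le Y L₀).image _, ?_⟩
  intro g hg hfin
  obtain ⟨s, L, n, h, hconj⟩ := exists_isCyclicGeodesic hp.surj htf hg hfin
  have hL := hL₀ s L n h
  refine ⟨_, ⟨(List.range L).map fun t => ⟨s (0 + t), hYs s L n h hL _⟩, by simpa using hL,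
    rfl⟩, ?_⟩
  have hp0 := pathVertex_add s 0 L
  rw [zero_add, pathVertex, one_mul] at hp0
  rw [hp0] at hconj
  simpa [segment, Function.comp_def] using hconj

end RelHyp

theorem exists_finiteIndex_notMem {G : Type*} [Group G]
    (hrf : ∀ g : G, g ≠ 1 → ∃ N : Subgroup G, N.Normal ∧ N.index ≠ 0 ∧ g ∉ N)
    {E : Set G} (hE : E.Finite) :
    ∃ N : Subgroup G, N.Normal ∧ N.index ≠ 0 ∧ ∀ e ∈ E, e ≠ 1 → e ∉ N := by
  induction E, hE using Set.Finite.induction_on with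
  | empty => exact ⟨⊤, inferInstance, by simp, by simp⟩
  | @insert a E _ _ ih =>
    obtain ⟨N, hN, hNi, hNE⟩ := ih
    by_cases ha : a = 1
    · refine ⟨N, hN, hNi, ?_⟩
      rintro e (rfl | he) h1
      · exact absurd ha h1
      · exact hNE e he h1
    · obtain ⟨N', hN', hNi', haN'⟩ := hrf a ha
      refine ⟨N ⊓ N', inferInstance, Subgroup.index_inf_ne_zero hNi hNi', ?_⟩
      rintro e (rfl | he) h1 hmem
      · exact haN' hmem.2
      · exact hNE e he h1 hmem.1

/-- Corollary 1.15 / Corollary 4.10. If `G` is hyperbolic relative to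
torsion-free subgroups `{H_λ}_{λ∈Λ}` and `G` is residually finite, then `G` is virtually
torsion-free. -/
theorem statement_14 {G : Type*} [Group G] {Λ : Type*} (H : Λ → Subgroup G)
    (hhyp : IsRelHyperbolic H)
    (htf : ∀ l : Λ, ∀ h ∈ H l, h ≠ 1 → ¬ IsOfFinOrder h)
    (hrf : ∀ g : G, g ≠ 1 → ∃ N : Subgroup G, N.Normal ∧ N.index ≠ 0 ∧ g ∉ N) :
    ∃ K : Subgroup G, K.index ≠ 0 ∧ ∀ k ∈ K, k ≠ 1 → ¬ IsOfFinOrder k := by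
  obtain ⟨E, hE, hconj⟩ := hhyp.exists_finite_conj htf
  obtain ⟨N, hN, hNi, hNE⟩ := exists_finiteIndex_notMem hrf hE
  refine ⟨N, hNi, fun k hk hk1 hfin => ?_⟩
  obtain ⟨e, he, hke⟩ := hconj k hk1 hfin
  refine hNE e he ?_ ?_
  · rintro rfl
    exact hk1 (isConj_one_left.mp hke)
  · obtain ⟨x, rfl⟩ := isConj_iff.mp hke
    exact hN.conj_mem k hk x
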